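/- arXiv:1812.01574 — 4 statements merged into one kernel-verified Lean document; each statement's English description precedes it below -/
import Mathlib

section
/- Let n, r be natural numbers with 1 ≤ r < n. Let Ψ ∈ ℝ^{n×r}, Φ ∈ ℝ^{n×r}, and let Ĉ ∈ ℝ^{r×n} be such that the r×r matrix ĈΨ is invertible. Define the projection P_C := Ψ (ĈΨ)⁻¹ Ĉ ∈ ℝ^{n×n}. Then for every x ∈ ℝⁿ, with x⋆ := Ψ Φᵀ x, one has ‖x − P_C x‖₂ ≤ ‖Ψ‖₂ · ‖(ĈΨ)⁻¹‖₂ · ‖Ĉ‖₂ · ‖x − x⋆‖₂. -/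
open Matrix

/-- Spectral norm (ℓ₂→ℓ₂ operator norm) of a real matrix. -/
noncomputable def specNorm {m n : ℕ} (M : Matrix (Fin m) (Fin n) ℝ) : ℝ :=
  ‖LinearMap.toContinuousLinearMap (Matrix.toEuclideanLin M)‖

/-- Euclidean norm of a vector in ℝⁿ. -/
noncomputable def euclNorm {n : ℕ} (x : Fin n → ℝ) : ℝ :=
  ‖(EuclideanSpace.equiv (Fin n) ℝ).symm x‖

/-- The swapping identity behind the equality of the norms of complementary projections. -/
theorem norm_normSq_smul_add_normSq_smul {E : Type*} [NormedAddCommGroup E]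
    [InnerProductSpace ℝ E] (u v : E) :
    ‖‖v‖ ^ 2 • u + ‖u‖ ^ 2 • v‖ = ‖u‖ * ‖v‖ * ‖u + v‖ := by
  rw [← sq_eq_sq₀ (by positivity) (by positivity), mul_pow, norm_add_sq_real, norm_add_sq_real,
    norm_smul, norm_smul, inner_smul_left, inner_smul_right]
  simp
  ring

theorem one_le_norm_of_isIdempotentElem {R : Type*} [NonUnitalNormedRing R] {p : R}
    (hp : IsIdempotentElem p) (h0 : p ≠ 0) : 1 ≤ ‖p‖ := by
  have h : ‖p‖ ≤ ‖p‖ * ‖p‖ := by simpa [hp.eq] using norm_mul_le p p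
  exact le_of_mul_le_mul_right (by simpa using h) (norm_pos_iff.mpr h0)

/-- A nonzero idempotent `p` on a real inner product space satisfies `‖1 - p‖ ≤ ‖p‖`. -/
theorem norm_sub_apply_le_of_isIdempotentElem {E : Type*} [NormedAddCommGroup E]
    [InnerProductSpace ℝ E] {p : E →L[ℝ] E} (hp : IsIdempotentElem p) (h0 : p ≠ 0) (y : E) :
    ‖y - p y‖ ≤ ‖p‖ * ‖y‖ := by
  have hpp : p (p y) = p y := DFunLike.congr_fun hp.eq y
  rcases eq_or_ne (p y) 0 with hu | hu
  · rw [hu, sub_zero]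
    exact le_mul_of_one_le_left (norm_nonneg y) (one_le_norm_of_isIdempotentElem hp h0)
  rcases eq_or_ne (y - p y) 0 with hv | hv
  · rw [hv, norm_zero]
    positivity
  have h := p.le_opNorm (‖y - p y‖ ^ 2 • p y + ‖p y‖ ^ 2 • (y - p y))
  rw [norm_normSq_smul_add_normSq_smul, add_sub_cancel] at h
  simp only [map_add, map_smul, map_sub, hpp, sub_self, smul_zero, add_zero, norm_smul,
    norm_pow, norm_norm] at h
  have hpos : 0 < ‖p y‖ * ‖y - p y‖ := by positivity
  refine le_of_mul_le_mul_left ?_ hpos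
  linarith

open scoped Matrix.Norms.L2Operator in
theorem specNorm_eq_l2_opNorm {m n : ℕ} (M : Matrix (Fin m) (Fin n) ℝ) : specNorm M = ‖M‖ :=
  (Matrix.l2_opNorm_def M).symm

theorem specNorm_nonneg {m n : ℕ} (M : Matrix (Fin m) (Fin n) ℝ) : 0 ≤ specNorm M :=
  norm_nonneg _

theorem euclNorm_nonneg {n : ℕ} (x : Fin n → ℝ) : 0 ≤ euclNorm x :=
  norm_nonneg _

open scoped Matrix.Norms.L2Operator in
theorem specNorm_mul_le {l m n : ℕ} (A : Matrix (Fin l) (Fin m) ℝ)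
    (B : Matrix (Fin m) (Fin n) ℝ) : specNorm (A * B) ≤ specNorm A * specNorm B := by
  simpa only [specNorm_eq_l2_opNorm] using Matrix.l2_opNorm_mul A B

theorem euclNorm_sub_mulVec_le {n : ℕ} {P : Matrix (Fin n) (Fin n) ℝ}
    (hP : IsIdempotentElem P) (h0 : P ≠ 0) (y : Fin n → ℝ) :
    euclNorm (y - P.mulVec y) ≤ specNorm P * euclNorm y :=
  norm_sub_apply_le_of_isIdempotentElem (p := Matrix.toEuclideanCLM (𝕜 := ℝ) P)
    (hP.map (Matrix.toEuclideanCLM (n := Fin n) (𝕜 := ℝ)))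
    ((map_ne_zero_iff _ (Matrix.toEuclideanCLM (n := Fin n) (𝕜 := ℝ)).injective).mpr h0)
    (WithLp.toLp 2 y)

/-- Interpolation error bound for the oblique projector `P_C = Ψ (ĈΨ)⁻¹ Ĉ`. -/
theorem interp_error_bound_sensors {n r : ℕ} (hr : 1 ≤ r) (hrn : r < n)
    (Ψ Φ : Matrix (Fin n) (Fin r) ℝ) (Chat : Matrix (Fin r) (Fin n) ℝ)
    (hinv : IsUnit (Chat * Ψ))
    (PC : Matrix (Fin n) (Fin n) ℝ) (hPC : PC = Ψ * (Chat * Ψ)⁻¹ * Chat)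
    (x xstar : Fin n → ℝ) (hxstar : xstar = Ψ.mulVec (Φᵀ.mulVec x)) :
    euclNorm (x - PC.mulVec x) ≤
      specNorm Ψ * specNorm (Chat * Ψ)⁻¹ * specNorm Chat * euclNorm (x - xstar) := by
  subst hPC hxstar
  have hdet : IsUnit (Chat * Ψ).det := (Matrix.isUnit_iff_isUnit_det _).mp hinv
  have hfix : Ψ * (Chat * Ψ)⁻¹ * Chat * Ψ = Ψ := by
    rw [Matrix.mul_assoc, Matrix.mul_assoc, Matrix.nonsing_inv_mul _ hdet, Matrix.mul_one]
  have hidem : IsIdempotentElem (Ψ * (Chat * Ψ)⁻¹ * Chat) := by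
    rw [IsIdempotentElem, ← Matrix.mul_assoc, ← Matrix.mul_assoc, hfix]
  have hne : Ψ * (Chat * Ψ)⁻¹ * Chat ≠ 0 := by
    intro h
    have : Nonempty (Fin r) := ⟨⟨0, hr⟩⟩
    have hΨ : Ψ = 0 := by rw [← hfix, h, Matrix.zero_mul]
    exact hinv.ne_zero (by rw [hΨ, Matrix.mul_zero])
  have hres : x - (Ψ * (Chat * Ψ)⁻¹ * Chat).mulVec x =
      (x - Ψ.mulVec (Φᵀ.mulVec x)) -
        (Ψ * (Chat * Ψ)⁻¹ * Chat).mulVec (x - Ψ.mulVec (Φᵀ.mulVec x)) := by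
    rw [Matrix.mulVec_sub, Matrix.mulVec_mulVec _ _ Ψ, hfix]
    abel
  rw [hres]
  refine (euclNorm_sub_mulVec_le hidem hne _).trans
    (mul_le_mul_of_nonneg_right ?_ (euclNorm_nonneg _))
  exact (specNorm_mul_le _ _).trans
    (mul_le_mul_of_nonneg_right (specNorm_mul_le _ _) (specNorm_nonneg _))
end

section
/- (Businger–Golub pivoting existence.) For every matrix V ∈ ℝ^{r×p}, there exist a permutation matrix P ∈ ℝ^{p×p}, an orthogonal matrix Q ∈ ℝ^{r×r}, and an upper triangular matrix R ∈ ℝ^{r×p} satisfying the Businger–Golub diagonal dominance property, such that V P = Q R. -/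
open Matrix

/-- A permutation matrix: exactly one entry 1 in each row and column, zeros elsewhere. -/
def IsPermMatrix {p : ℕ} (P : Matrix (Fin p) (Fin p) ℝ) : Prop :=
  ∃ σ : Equiv.Perm (Fin p), P = σ.permMatrix ℝ

/-- Upper triangular (possibly rectangular) matrix: `R j k = 0` for `j > k`. -/
def IsUpperTri {r p : ℕ} (R : Matrix (Fin r) (Fin p) ℝ) : Prop :=
  ∀ (j : Fin r) (k : Fin p), (k : ℕ) < (j : ℕ) → R j k = 0

/-- Businger–Golub diagonal dominance:
`|R i i|² ≥ Σ_{j=i}^{min(k,r)} |R j k|²` for all `i ≤ k`. -/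
def BusingerGolub {r p : ℕ} (R : Matrix (Fin r) (Fin p) ℝ) : Prop :=
  ∀ (i : Fin r) (ip : Fin p) (k : Fin p), (i : ℕ) = (ip : ℕ) → (ip : ℕ) ≤ (k : ℕ) →
    (∑ j : Fin r, if (i : ℕ) ≤ (j : ℕ) ∧ (j : ℕ) ≤ (k : ℕ) then (R j k) ^ 2 else 0)
      ≤ (R i ip) ^ 2

/-- Some orthogonal matrix maps a given vector to a multiple of the first basis vector. -/
theorem exists_orthogonal_mulVec_succ_eq_zero {n : ℕ} (v : Fin (n + 1) → ℝ) :
    ∃ U : Matrix (Fin (n + 1)) (Fin (n + 1)) ℝ, U * Uᵀ = 1 ∧ ∀ i : Fin n, (U *ᵥ v) i.succ = 0 := by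
  let f : Fin (n + 1) → EuclideanSpace ℝ (Fin (n + 1)) := fun _ => WithLp.toLp 2 v
  let b := InnerProductSpace.gramSchmidtOrthonormalBasis (𝕜 := ℝ) (by simp) f
  refine ⟨Matrix.of fun i j => b i j, ?_, fun i => ?_⟩
  · ext i j
    have h := orthonormal_iff_ite.mp b.orthonormal i j
    simp only [PiLp.inner_apply, RCLike.inner_apply, conj_trivial] at h
    simpa [Matrix.mul_apply, Matrix.one_apply, mul_comm] using h
  · have h := InnerProductSpace.gramSchmidtOrthonormalBasis_inv_triangular (𝕜 := ℝ) (by simp) f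
      (Fin.succ_pos i)
    simp only [PiLp.inner_apply, RCLike.inner_apply, conj_trivial] at h
    simpa [Matrix.mulVec, dotProduct, mul_comm, f, b] using h

/-- Left multiplication by an orthogonal matrix preserves the norms of columns. -/
theorem sum_sq_mul_apply_of_orthogonal {r p : ℕ} {U : Matrix (Fin r) (Fin r) ℝ}
    (hU : U * Uᵀ = 1) (A : Matrix (Fin r) (Fin p) ℝ) (k : Fin p) :
    ∑ j, (U * A) j k ^ 2 = ∑ j, A j k ^ 2 := by
  have h : (U * A)ᵀ * (U * A) = Aᵀ * A := by
    rw [Matrix.transpose_mul, Matrix.mul_assoc, ← Matrix.mul_assoc Uᵀ,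
      mul_eq_one_comm.mp hU, Matrix.one_mul]
  have h' := congrFun (congrFun h k) k
  rw [Matrix.mul_apply, Matrix.mul_apply] at h'
  simpa only [Matrix.transpose_apply, ← sq] using h'

/-- The block diagonal matrix with blocks `1` and `U`. -/
def oneBlockDiag {r : ℕ} (U : Matrix (Fin r) (Fin r) ℝ) :
    Matrix (Fin (r + 1)) (Fin (r + 1)) ℝ :=
  Matrix.of (Fin.cons (Fin.cons 1 0) fun i => Fin.cons 0 (U i))

theorem oneBlockDiag_mul_transpose {r : ℕ} {U : Matrix (Fin r) (Fin r) ℝ} (hU : U * Uᵀ = 1) :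
    oneBlockDiag U * (oneBlockDiag U)ᵀ = 1 := by
  ext i j
  refine Fin.cases ?_ (fun i => ?_) i <;> refine Fin.cases ?_ (fun j => ?_) j
  · simp [oneBlockDiag, Matrix.mul_apply, Fin.sum_univ_succ]
  · simp [oneBlockDiag, Matrix.mul_apply, Fin.sum_univ_succ, (Fin.succ_ne_zero j).symm]
  · simp [oneBlockDiag, Matrix.mul_apply, Fin.sum_univ_succ]
  · have h := congrFun (congrFun hU i) j
    simpa [oneBlockDiag, Matrix.mul_apply, Fin.sum_univ_succ, Matrix.one_apply] using h

theorem oneBlockDiag_mul_apply_succ {r p : ℕ} (U : Matrix (Fin r) (Fin r) ℝ)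
    (A : Matrix (Fin (r + 1)) (Fin p) ℝ) (i : Fin r) (k : Fin p) :
    (oneBlockDiag U * A) i.succ k = ∑ j, U i j * A j.succ k := by
  simp [oneBlockDiag, Matrix.mul_apply, Fin.sum_univ_succ]

/-- Orthogonal triangularization with column pivoting. -/
theorem exists_orthogonal_perm_isUpperTri_businger_golub (r : ℕ) :
    ∀ {p : ℕ} (V : Matrix (Fin r) (Fin p) ℝ),
      ∃ (σ : Equiv.Perm (Fin p)) (U : Matrix (Fin r) (Fin r) ℝ), U * Uᵀ = 1 ∧
        IsUpperTri (U * V.submatrix id σ) ∧ BusingerGolub (U * V.submatrix id σ) := by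
  induction r with
  | zero =>
    intro p V
    exact ⟨1, 1, by simp, fun j => j.elim0, fun i => i.elim0⟩
  | succ r ih =>
    intro p V
    cases p with
    | zero => exact ⟨1, 1, by simp, fun _ k => k.elim0, fun _ k => k.elim0⟩
    | succ p =>
      obtain ⟨m, hm⟩ := Finite.exists_max fun k => ∑ j, V j k ^ 2
      obtain ⟨U₁, hU₁, hv⟩ := exists_orthogonal_mulVec_succ_eq_zero fun j => V j m
      obtain ⟨τ, U₂, hU₂, htri, hbg⟩ := ih
        (Matrix.of fun (j : Fin r) (k : Fin p) => (U₁ * V) j.succ (Equiv.swap 0 m k.succ))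
      set R₂ : Matrix (Fin r) (Fin p) ℝ := U₂ * (Matrix.of fun (j : Fin r) (k : Fin p) =>
        (U₁ * V) j.succ (Equiv.swap 0 m k.succ)).submatrix id τ with hR₂
      let σ := Equiv.Perm.decomposeFin.symm (m, τ)
      have hU : (oneBlockDiag U₂ * U₁) * (oneBlockDiag U₂ * U₁)ᵀ = 1 := by
        rw [Matrix.transpose_mul, Matrix.mul_assoc, ← Matrix.mul_assoc U₁, hU₁, Matrix.one_mul,
          oneBlockDiag_mul_transpose hU₂]
      refine ⟨σ, oneBlockDiag U₂ * U₁, hU, ?_⟩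
      set R := oneBlockDiag U₂ * U₁ * V.submatrix id σ with hR
      have hR_apply (i : Fin r) (k : Fin (p + 1)) :
          R i.succ k = ∑ j, U₂ i j * (U₁ * V) j.succ (σ k) := by
        rw [hR, Matrix.mul_assoc, oneBlockDiag_mul_apply_succ]
        simp [Matrix.mul_apply]
      have hcol (i : Fin r) : R i.succ 0 = 0 := by
        rw [hR_apply]
        refine Finset.sum_eq_zero fun j _ => mul_eq_zero_of_right _ ?_
        simpa [σ, Matrix.mul_apply, Matrix.mulVec, dotProduct] using hv j
      have hblock (i : Fin r) (k : Fin p) : R i.succ k.succ = R₂ i k := by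
        rw [hR_apply, hR₂, Matrix.mul_apply]
        simp [σ]
      have hnorm (k : Fin (p + 1)) : ∑ j, R j k ^ 2 = ∑ j, V j (σ k) ^ 2 := by
        simpa using sum_sq_mul_apply_of_orthogonal hU (V.submatrix id σ) k
      have hpivot : R 0 0 ^ 2 = ∑ j, V j m ^ 2 := by
        have h := hnorm 0
        simpa [Fin.sum_univ_succ (fun j => R j 0 ^ 2), hcol, σ] using h
      refine ⟨fun j k hkj => ?_, fun i l k hil hlk => ?_⟩
      · cases j using Fin.cases with
        | zero => simp at hkj
        | succ j =>
          cases k using Fin.cases with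
          | zero => exact hcol j
          | succ k =>
            rw [hblock]
            exact htri j k (by simpa using hkj)
      · cases i using Fin.cases with
        | zero =>
          obtain rfl : l = 0 := Fin.ext hil.symm
          rw [hpivot]
          refine le_trans (Finset.sum_le_sum fun j _ => ?_) ((hnorm k).trans_le (hm (σ k)))
          split_ifs
          · exact le_rfl
          · exact sq_nonneg _
        | succ i =>
          cases l using Fin.cases with
          | zero => simp at hil
          | succ l =>
            cases k using Fin.cases with
            | zero => simp at hlk
            | succ k =>
              have h := hbg i l k (by simpa using hil) (by simpa using hlk)
              simpa [Fin.sum_univ_succ (n := r), hblock] using h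

/-- Existence of a Businger–Golub pivoted QR factorization `V P = Q R` for any real
matrix `V`. -/
theorem businger_golub_existence {r p : ℕ} (V : Matrix (Fin r) (Fin p) ℝ) :
    ∃ (P : Matrix (Fin p) (Fin p) ℝ) (Q : Matrix (Fin r) (Fin r) ℝ)
      (R : Matrix (Fin r) (Fin p) ℝ),
      IsPermMatrix P ∧ Qᵀ * Q = 1 ∧ IsUpperTri R ∧ BusingerGolub R ∧ V * P = Q * R := by
  obtain ⟨σ, U, hU, htri, hbg⟩ := exists_orthogonal_perm_isUpperTri_businger_golub r V
  refine ⟨Equiv.Perm.permMatrix ℝ σ.symm, Uᵀ, U * V.submatrix id σ, ⟨σ.symm, rfl⟩, by simpa using hU,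
    htri, hbg, ?_⟩
  rw [← Matrix.mul_assoc, mul_eq_one_comm.mp hU, Matrix.one_mul]
  ext i k
  simp [Equiv.Perm.permMatrix, PEquiv.mul_toMatrix_toPEquiv]
end

section
/- (Log-determinant guarantee for QR pivot actuators.) Let Φ ∈ ℝ^{n×r} and B ∈ ℝ^{n×q} with r ≤ q, and suppose V := Φᵀ B ∈ ℝ^{r×q} has full row rank. Suppose V admits a pivoted QR factorization V P̃ = Q̃ R̃, where P̃ is a q×q permutation matrix, Q̃ ∈ ℝ^{r×r} is orthogonal, and R̃ ∈ ℝ^{r×q} is upper triangular satisfying the Businger–Golub diagonal dominance property. Let S_B ∈ ℝ^{q×r} consist of the first r columns of P̃, and set B̂ := B S_B. Let Σ_r = diag(σ₁, …, σ_r) with all σᵢ > 0 and Ŵ_o := Φ Σ_r Φᵀ. Then r · log( 9 σ_min(ΦᵀB)² / ((q − r + 1)(4^r + 6r − 1)) ) + Σ_{i=1}^{r} log σᵢ ≤ log det( B̂ᵀ Ŵ_o B̂ ). -/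
open Matrix

/-- Smallest singular value of a matrix: the infimum of `‖Ux‖₂` over the unit sphere. -/
noncomputable def sigmaMin {p r : ℕ} (U : Matrix (Fin p) (Fin r) ℝ) : ℝ :=
  sInf {c : ℝ | ∃ x : Fin r → ℝ, euclNorm x = 1 ∧ c = euclNorm (U.mulVec x)}

/-- The square of the Euclidean norm is the dot product of the vector with itself. -/
theorem euclNorm_sq {n : ℕ} (x : Fin n → ℝ) : euclNorm x ^ 2 = x ⬝ᵥ x := by
  simp [euclNorm, EuclideanSpace.norm_sq_eq, dotProduct, ← sq]

/-- A matrix whose transpose is a left inverse preserves the Euclidean norm. -/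
theorem euclNorm_mulVec_of_transpose_mul_self {m n : ℕ} {A : Matrix (Fin m) (Fin n) ℝ}
    (hA : Aᵀ * A = 1) (x : Fin n → ℝ) : euclNorm (A *ᵥ x) = euclNorm x := by
  rw [← sq_eq_sq₀ (euclNorm_nonneg _) (euclNorm_nonneg _), euclNorm_sq, euclNorm_sq,
    dotProduct_mulVec, ← mulVec_transpose, mulVec_mulVec, hA, one_mulVec]

theorem sigmaMin_nonneg {p r : ℕ} (U : Matrix (Fin p) (Fin r) ℝ) : 0 ≤ sigmaMin U := by
  refine Real.sInf_nonneg ?_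
  rintro c ⟨x, -, rfl⟩
  exact euclNorm_nonneg _

theorem sigmaMin_le {p r : ℕ} (U : Matrix (Fin p) (Fin r) ℝ) {x : Fin r → ℝ}
    (hx : euclNorm x = 1) : sigmaMin U ≤ euclNorm (U *ᵥ x) := by
  refine csInf_le ⟨0, ?_⟩ ⟨x, hx, rfl⟩
  rintro c ⟨y, -, rfl⟩
  exact euclNorm_nonneg _

/-- The smallest singular value of a nonempty matrix with linearly independent columns
is positive. -/
theorem sigmaMin_pos {p r : ℕ} (hr : 1 ≤ r) (U : Matrix (Fin p) (Fin r) ℝ)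
    (hU : Function.Injective U.mulVec) : 0 < sigmaMin U := by
  obtain ⟨K, hK, hlip⟩ := (toEuclideanLin U).exists_antilipschitzWith (by
    rw [LinearMap.ker_eq_bot]
    intro x y hxy
    refine WithLp.ofLp_injective 2 (hU ?_)
    simpa [toEuclideanLin, toLpLin_apply] using hxy)
  have hne : euclNorm (Pi.single (⟨0, hr⟩ : Fin r) (1 : ℝ)) = 1 := by
    rw [← sq_eq_sq₀ (euclNorm_nonneg _) zero_le_one, euclNorm_sq]
    simp
  refine lt_of_lt_of_le (b := (K : ℝ)⁻¹) (by positivity) (le_csInf ⟨_, _, hne, rfl⟩ ?_)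
  rintro c ⟨x, hx, rfl⟩
  have h : euclNorm x ≤ K * euclNorm (U *ᵥ x) :=
    hlip.le_mul_norm (map_zero _) (WithLp.toLp 2 x)
  rw [hx] at h
  rwa [inv_le_iff_one_le_mul₀' (by exact_mod_cast hK)]

theorem mulVec_injective_of_rank_transpose {p r : ℕ} {A : Matrix (Fin r) (Fin p) ℝ}
    (hA : A.rank = r) : Function.Injective Aᵀ.mulVec := by
  rw [mulVec_injective_iff, linearIndependent_iff_card_eq_finrank_span, Set.finrank,
    ← rank_eq_finrank_span_cols, rank_transpose, hA, Fintype.card_fin]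

/-- The diagonal entries of a Businger–Golub factor decrease in absolute value. -/
theorem BusingerGolub.sq_diag_le {r q : ℕ} {R : Matrix (Fin r) (Fin q) ℝ}
    (h : BusingerGolub R) (hrq : r ≤ q) {i l : Fin r} (hil : i ≤ l) :
    R l (Fin.castLE hrq l) ^ 2 ≤ R i (Fin.castLE hrq i) ^ 2 := by
  refine le_trans ?_ (h i (Fin.castLE hrq i) (Fin.castLE hrq l) rfl hil)
  refine le_trans ?_ (Finset.single_le_sum (fun j _ => by positivity) (Finset.mem_univ l))
  rw [if_pos ⟨hil, le_rfl⟩]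

/-- A diagonal entry of a Businger–Golub factor dominates the rest of its row. -/
theorem BusingerGolub.sq_le_sq_diag {r q : ℕ} {R : Matrix (Fin r) (Fin q) ℝ}
    (h : BusingerGolub R) (hrq : r ≤ q) {l : Fin r} {k : Fin q} (hlk : (l : ℕ) ≤ k) :
    R l k ^ 2 ≤ R l (Fin.castLE hrq l) ^ 2 := by
  refine le_trans ?_ (h l (Fin.castLE hrq l) k rfl hlk)
  refine le_trans ?_ (Finset.single_le_sum (fun j _ => by positivity) (Finset.mem_univ l))
  rw [if_pos ⟨le_rfl, hlk⟩]

/-- The squared norm of a row of a Businger–Golub factor is at most the squared diagonal entry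
times the number of entries from the diagonal on. -/
theorem BusingerGolub.sum_sq_row_le {r q : ℕ} {R : Matrix (Fin r) (Fin q) ℝ}
    (h : BusingerGolub R) (hR : IsUpperTri R) (hrq : r ≤ q) (l : Fin r) :
    ∑ k, R l k ^ 2 ≤ ((q : ℝ) - (l : ℕ)) * R l (Fin.castLE hrq l) ^ 2 := by
  have hsub : ∑ k ∈ Finset.Ici (Fin.castLE hrq l), R l k ^ 2 = ∑ k, R l k ^ 2 := by
    refine Finset.sum_subset (Finset.subset_univ _) fun k _ hk => ?_
    rw [hR l k (by simpa [Fin.lt_def] using hk), sq, mul_zero]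
  have hcard : ((Finset.Ici (Fin.castLE hrq l)).card : ℝ) = (q : ℝ) - (l : ℕ) := by
    rw [Fin.card_Ici, Fin.val_castLE, Nat.cast_sub (l.isLt.le.trans hrq)]
  rw [← hsub, ← hcard, ← nsmul_eq_mul]
  exact Finset.sum_le_card_nsmul _ _ _ fun k hk =>
    h.sq_le_sq_diag hrq (by simpa [Fin.le_def] using hk)

/-- In a pivoted QR factorization `V * P = Q * R`, the smallest singular value of `Vᵀ` is at most
the norm of any row of `R`. -/
theorem sigmaMin_transpose_sq_le_sum_sq_row {q r : ℕ} {V : Matrix (Fin r) (Fin q) ℝ}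
    {P : Matrix (Fin q) (Fin q) ℝ} {Q : Matrix (Fin r) (Fin r) ℝ} {R : Matrix (Fin r) (Fin q) ℝ}
    (hP : P * Pᵀ = 1) (hQ : Qᵀ * Q = 1) (hQR : V * P = Q * R) (l : Fin r) :
    sigmaMin Vᵀ ^ 2 ≤ ∑ k, R l k ^ 2 := by
  have hx : euclNorm (Q *ᵥ Pi.single l 1) = 1 := by
    rw [euclNorm_mulVec_of_transpose_mul_self hQ,
      ← sq_eq_sq₀ (euclNorm_nonneg _) zero_le_one, euclNorm_sq]
    simp
  have hrow : Pᵀ *ᵥ (Vᵀ *ᵥ (Q *ᵥ Pi.single l 1)) = R l := by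
    rw [mulVec_mulVec, mulVec_mulVec, ← transpose_mul, hQR, transpose_mul, Matrix.mul_assoc, hQ,
      Matrix.mul_one, mulVec_single_one]
    rfl
  have hnorm : euclNorm (Vᵀ *ᵥ (Q *ᵥ Pi.single l 1)) = euclNorm (R l) := by
    rw [← hrow, euclNorm_mulVec_of_transpose_mul_self (A := Pᵀ) (by rwa [transpose_transpose])]
  calc sigmaMin Vᵀ ^ 2 ≤ euclNorm (R l) ^ 2 :=
        pow_le_pow_left₀ (sigmaMin_nonneg _) (hnorm ▸ sigmaMin_le Vᵀ hx) 2
    _ = ∑ k, R l k ^ 2 := by simp only [euclNorm_sq, dotProduct, ← sq]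

theorem IsPermMatrix.mul_transpose_self {p : ℕ} {P : Matrix (Fin p) (Fin p) ℝ}
    (hP : IsPermMatrix P) : P * Pᵀ = 1 := by
  obtain ⟨s, rfl⟩ := hP
  rw [transpose_permMatrix, ← permMatrix_mul, inv_mul_cancel, permMatrix_one]

/-- The determinant of the compressed gramian is the product of the weights and of the squared
diagonal entries of `R`. -/
theorem det_transpose_mul_diagonal_mul {q r : ℕ} (hrq : r ≤ q) {Q : Matrix (Fin r) (Fin r) ℝ}
    {R : Matrix (Fin r) (Fin q) ℝ} (hQ : Qᵀ * Q = 1) (hR : IsUpperTri R) (σ : Fin r → ℝ) :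
    ((Q * R.submatrix id (Fin.castLE hrq))ᵀ * diagonal σ *
      (Q * R.submatrix id (Fin.castLE hrq))).det
      = (∏ i, R i (Fin.castLE hrq i) ^ 2) * ∏ i, σ i := by
  have hdet : (R.submatrix id (Fin.castLE hrq)).det = ∏ i, R i (Fin.castLE hrq i) :=
    det_of_isUpperTriangular fun i j hij => hR _ _ hij
  have hQdet : Q.det * Q.det = 1 := by
    simpa using congrArg Matrix.det hQ
  rw [det_mul, det_mul, det_transpose, det_mul, det_diagonal, hdet, Finset.prod_pow]
  linear_combination (∏ i, R i (Fin.castLE hrq i)) ^ 2 * (∏ i, σ i) * hQdet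

/-- Log-determinant guarantee for QR pivot actuators.  Here `σ_min(ΦᵀB)` is expressed as
`sigmaMin (Bᵀ * Φ)`, the smallest singular value of the (tall) transpose, which equals the
smallest singular value of `ΦᵀB`. -/
theorem logdet_guarantee_actuators {n q r : ℕ} (hr : 1 ≤ r) (hrq : r ≤ q)
    (Φ : Matrix (Fin n) (Fin r) ℝ) (B : Matrix (Fin n) (Fin q) ℝ)
    (hrank : (Φᵀ * B).rank = r)
    (Pt : Matrix (Fin q) (Fin q) ℝ) (hP : IsPermMatrix Pt)
    (Qt : Matrix (Fin r) (Fin r) ℝ) (hQ : Qtᵀ * Qt = 1)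
    (Rt : Matrix (Fin r) (Fin q) ℝ) (hRtri : IsUpperTri Rt) (hRbg : BusingerGolub Rt)
    (hQR : (Φᵀ * B) * Pt = Qt * Rt)
    (SB : Matrix (Fin q) (Fin r) ℝ)
    (hSB : SB = Matrix.of fun (j : Fin q) (i : Fin r) => Pt j (Fin.castLE hrq i))
    (Bhat : Matrix (Fin n) (Fin r) ℝ) (hBhat : Bhat = B * SB)
    (σ : Fin r → ℝ) (hσ : ∀ i, 0 < σ i)
    (Wo : Matrix (Fin n) (Fin n) ℝ) (hWo : Wo = Φ * Matrix.diagonal σ * Φᵀ) :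
    (r : ℝ) * Real.log (9 * sigmaMin (Bᵀ * Φ) ^ 2 /
          (((q : ℝ) - r + 1) * ((4 : ℝ) ^ r + 6 * r - 1)))
        + ∑ i, Real.log (σ i)
      ≤ Real.log (Bhatᵀ * Wo * Bhat).det := by
  have hV : Φᵀ * Bhat = Qt * Rt.submatrix id (Fin.castLE hrq) := by
    have hS : SB = Pt.submatrix id (Fin.castLE hrq) := hSB
    rw [hBhat, ← Matrix.mul_assoc, hS]
    exact congrArg (fun M => M.submatrix id (Fin.castLE hrq)) hQR
  have hdet : (Bhatᵀ * Wo * Bhat).det = (∏ i, Rt i (Fin.castLE hrq i) ^ 2) * ∏ i, σ i := by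
    rw [← det_transpose_mul_diagonal_mul hrq hQ hRtri, ← hV, hWo]
    simp only [transpose_mul, transpose_transpose, Matrix.mul_assoc]
  have hVt : (Φᵀ * B)ᵀ = Bᵀ * Φ := by rw [transpose_mul, transpose_transpose]
  have hs : 0 < sigmaMin (Bᵀ * Φ) :=
    hVt ▸ sigmaMin_pos hr _ (mulVec_injective_of_rank_transpose hrank)
  set l : Fin r := ⟨r - 1, by omega⟩ with hl
  have hlast : sigmaMin (Bᵀ * Φ) ^ 2 ≤ ((q : ℝ) - r + 1) * Rt l (Fin.castLE hrq l) ^ 2 := by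
    have h := (sigmaMin_transpose_sq_le_sum_sq_row hP.mul_transpose_self hQ hQR l).trans
      (hRbg.sum_sq_row_le hRtri hrq l)
    rw [hVt] at h
    have hlr : ((l : ℕ) : ℝ) = r - 1 := by simp [hl, Nat.cast_sub hr]
    rwa [hlr, ← sub_add] at h
  have hqr : 0 < (q : ℝ) - r + 1 := by
    have : (r : ℝ) ≤ q := by exact_mod_cast hrq
    linarith
  have hgrow : 9 ≤ (4 : ℝ) ^ r + 6 * r - 1 := by
    have h1 : (1 : ℝ) ≤ r := by exact_mod_cast hr
    have h4 : (4 : ℝ) ^ 1 ≤ 4 ^ r := pow_le_pow_right₀ (by norm_num) hr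
    linarith
  have hbound_pos : 0 < 9 * sigmaMin (Bᵀ * Φ) ^ 2 /
      (((q : ℝ) - r + 1) * ((4 : ℝ) ^ r + 6 * r - 1)) := by
    have : 0 < (4 : ℝ) ^ r + 6 * r - 1 := by linarith
    positivity
  have hdiag (i : Fin r) : 9 * sigmaMin (Bᵀ * Φ) ^ 2 /
      (((q : ℝ) - r + 1) * ((4 : ℝ) ^ r + 6 * r - 1)) ≤ Rt i (Fin.castLE hrq i) ^ 2 := by
    have hil : i ≤ l := by
      have := i.isLt
      simp only [hl, Fin.le_def]
      omega
    refine le_trans ?_ (hRbg.sq_diag_le hrq hil)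
    rw [div_le_iff₀ (mul_pos hqr (by linarith))]
    calc 9 * sigmaMin (Bᵀ * Φ) ^ 2
        ≤ ((4 : ℝ) ^ r + 6 * r - 1) * (((q : ℝ) - r + 1) * Rt l (Fin.castLE hrq l) ^ 2) :=
          mul_le_mul hgrow hlast (by positivity) (by linarith)
      _ = _ := by ring
  have hne (i : Fin r) : Rt i (Fin.castLE hrq i) ^ 2 ≠ 0 := (hbound_pos.trans_le (hdiag i)).ne'
  rw [hdet, Real.log_mul (Finset.prod_ne_zero_iff.2 fun i _ => hne i)
    (Finset.prod_ne_zero_iff.2 fun i _ => (hσ i).ne'), Real.log_prod fun i _ => hne i,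
    Real.log_prod fun i _ => (hσ i).ne']
  gcongr
  simpa using Finset.card_nsmul_le_sum Finset.univ
    (fun i : Fin r => Real.log (Rt i (Fin.castLE hrq i) ^ 2)) _
    fun i _ => Real.log_le_log hbound_pos (hdiag i)
end

section
/- (Existence of the balancing transformation.) Let W_c, W_o ∈ ℝ^{n×n} be symmetric positive definite. Then there exist an invertible matrix Ψ ∈ ℝ^{n×n} and a diagonal matrix Σ ∈ ℝ^{n×n} with strictly positive diagonal entries such that Ψ⁻¹ W_c (Ψ⁻¹)ᵀ = Σ and Ψᵀ W_o Ψ = Σ; consequently both transformed gramians are equal and diagonal and W_c W_o Ψ = Ψ Σ². -/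
open Matrix

/-- A real positive definite matrix is orthogonally similar to a positive diagonal matrix. -/
theorem Matrix.PosDef.exists_orthogonal_diagonalization {n : Type*} [Fintype n] [DecidableEq n]
    {A : Matrix n n ℝ} (hA : A.PosDef) :
    ∃ (U : Matrix n n ℝ) (μ : n → ℝ),
      Uᵀ * U = 1 ∧ (∀ i, 0 < μ i) ∧ Uᵀ * A * U = diagonal μ := by
  refine ⟨hA.isHermitian.eigenvectorUnitary, hA.isHermitian.eigenvalues, ?_,
    hA.eigenvalues_pos, ?_⟩
  · simpa [star_eq_conjTranspose] using
      Unitary.coe_star_mul_self hA.isHermitian.eigenvectorUnitary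
  · simpa [Unitary.conjStarAlgAut_star_apply, star_eq_conjTranspose, Function.comp_def] using
      hA.isHermitian.conjStarAlgAut_star_eigenvectorUnitary

/-- A real positive definite matrix is congruent to the identity. -/
theorem Matrix.PosDef.exists_transpose_mul_mul_eq_one {n : Type*} [Fintype n] [DecidableEq n]
    {A : Matrix n n ℝ} (hA : A.PosDef) :
    ∃ R : Matrix n n ℝ, IsUnit R ∧ R * A * Rᵀ = 1 := by
  obtain ⟨U, μ, hU, hμ, hAU⟩ := hA.exists_orthogonal_diagonalization
  have hs : IsUnit (diagonal fun i ↦ (√(μ i))⁻¹) :=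
    isUnit_diagonal.2 (Pi.isUnit_iff.2 fun i ↦
      (inv_ne_zero (Real.sqrt_pos.2 (hμ i)).ne').isUnit)
  refine ⟨(diagonal fun i ↦ (√(μ i))⁻¹) * Uᵀ, hs.mul (IsUnit.of_mul_eq_one _ hU), ?_⟩
  calc (diagonal fun i ↦ (√(μ i))⁻¹) * Uᵀ * A * ((diagonal fun i ↦ (√(μ i))⁻¹) * Uᵀ)ᵀ
      = (diagonal fun i ↦ (√(μ i))⁻¹) * (Uᵀ * A * U) * diagonal fun i ↦ (√(μ i))⁻¹ := by
        simp only [transpose_mul, transpose_transpose, diagonal_transpose, Matrix.mul_assoc]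
    _ = 1 := by
        rw [hAU, diagonal_mul_diagonal, diagonal_mul_diagonal, ← diagonal_one]
        congr 1
        funext i
        have h := Real.sqrt_pos.2 (hμ i)
        field_simp
        exact (Real.sq_sqrt (hμ i).le).symm

/-- Existence of the balancing transformation: for symmetric positive definite gramians
`W_c`, `W_o`, there is an invertible `Ψ` and a positive diagonal `Σ` with
`Ψ⁻¹ W_c (Ψ⁻¹)ᵀ = Σ`, `Ψᵀ W_o Ψ = Σ`, and consequently `W_c W_o Ψ = Ψ Σ²`. -/
theorem balancing_transformation_exists {n : ℕ}
    (Wc Wo : Matrix (Fin n) (Fin n) ℝ) (hWc : Wc.PosDef) (hWo : Wo.PosDef) :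
    ∃ (Ψ : Matrix (Fin n) (Fin n) ℝ) (σ : Fin n → ℝ),
      IsUnit Ψ ∧ (∀ i, 0 < σ i) ∧
      Ψ⁻¹ * Wc * (Ψ⁻¹)ᵀ = Matrix.diagonal σ ∧
      Ψᵀ * Wo * Ψ = Matrix.diagonal σ ∧
      Wc * Wo * Ψ = Ψ * (Matrix.diagonal σ) ^ 2 := by
  obtain ⟨R, hR, hRW⟩ := hWc.exists_transpose_mul_mul_eq_one
  have hRi : R⁻¹ * R = 1 := nonsing_inv_mul R ((isUnit_iff_isUnit_det R).1 hR)
  have hRi' : R * R⁻¹ = 1 := mul_nonsing_inv R ((isUnit_iff_isUnit_det R).1 hR)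
  have hM : ((R⁻¹)ᵀ * Wo * R⁻¹).PosDef := by
    have := hWo.conjTranspose_mul_mul_same
      (mulVec_injective_of_isUnit (IsUnit.of_mul_eq_one _ hRi))
    simpa using this
  obtain ⟨U, μ, hU, hμ, hUM⟩ := hM.exists_orthogonal_diagonalization
  set d : Fin n → ℝ := fun i ↦ √(√(μ i))
  have hd0 : ∀ i, 0 < d i := fun i ↦ Real.sqrt_pos.2 (Real.sqrt_pos.2 (hμ i))
  have hd2 : ∀ i, d i * d i = √(μ i) := fun i ↦ Real.mul_self_sqrt (Real.sqrt_nonneg _)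
  have hde : diagonal d * diagonal d⁻¹ = 1 := by
    rw [diagonal_mul_diagonal, ← diagonal_one]
    congr 1
    funext i
    exact mul_inv_cancel₀ (hd0 i).ne'
  set Ψ := R⁻¹ * U * diagonal d⁻¹ with hΨ
  have hΦΨ : diagonal d * Uᵀ * R * Ψ = 1 := by
    calc diagonal d * Uᵀ * R * Ψ
        = diagonal d * (Uᵀ * (R * R⁻¹) * U) * diagonal d⁻¹ := by
          simp only [hΨ, Matrix.mul_assoc]
      _ = 1 := by rw [hRi', Matrix.mul_one, hU, Matrix.mul_one, hde]
  have hinv : Ψ⁻¹ = diagonal d * Uᵀ * R := inv_eq_left_inv hΦΨ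
  have hΨΦ : Ψ * Ψ⁻¹ = 1 := by rw [hinv]; exact mul_eq_one_comm.1 hΦΨ
  have hc : Ψ⁻¹ * Wc * (Ψ⁻¹)ᵀ = diagonal fun i ↦ √(μ i) := by
    calc Ψ⁻¹ * Wc * (Ψ⁻¹)ᵀ = diagonal d * (Uᵀ * (R * Wc * Rᵀ) * U) * diagonal d := by
          simp only [hinv, transpose_mul, transpose_transpose, diagonal_transpose,
            Matrix.mul_assoc]
      _ = diagonal fun i ↦ √(μ i) := by
          rw [hRW, Matrix.mul_one, hU, Matrix.mul_one, diagonal_mul_diagonal]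
          simp only [hd2]
  have ho : Ψᵀ * Wo * Ψ = diagonal fun i ↦ √(μ i) := by
    calc Ψᵀ * Wo * Ψ
        = diagonal d⁻¹ * (Uᵀ * ((R⁻¹)ᵀ * Wo * R⁻¹) * U) * diagonal d⁻¹ := by
          simp only [hΨ, transpose_mul, diagonal_transpose, Matrix.mul_assoc]
      _ = diagonal fun i ↦ √(μ i) := by
          rw [hUM, diagonal_mul_diagonal, diagonal_mul_diagonal]
          congr 1
          funext i
          have h := hd0 i
          have hμi : μ i = (d i * d i) * (d i * d i) := by
            rw [hd2, Real.mul_self_sqrt (hμ i).le]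
          rw [← hd2 i, Pi.inv_apply, hμi]
          field_simp
  refine ⟨Ψ, fun i ↦ √(μ i), IsUnit.of_mul_eq_one _ hΨΦ, fun i ↦ Real.sqrt_pos.2 (hμ i),
    hc, ho, ?_⟩
  have hΨΦt : (Ψ⁻¹)ᵀ * Ψᵀ = 1 := by rw [← transpose_mul, hΨΦ, transpose_one]
  calc Wc * Wo * Ψ = (Ψ * Ψ⁻¹) * Wc * ((Ψ⁻¹)ᵀ * Ψᵀ) * Wo * Ψ := by
        rw [hΨΦ, hΨΦt, Matrix.one_mul, Matrix.mul_one]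
    _ = Ψ * ((Ψ⁻¹ * Wc * (Ψ⁻¹)ᵀ) * (Ψᵀ * Wo * Ψ)) := by
        simp only [Matrix.mul_assoc]
    _ = Ψ * (diagonal fun i ↦ √(μ i)) ^ 2 := by rw [hc, ho, sq]
end
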